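/- An identity u ≈ v over an alphabet of variables X is satisfied by the hypoplactic monoid hypo if and only if it is balanced and, for all variables x, y occurring in u or v, the word u admits the two-letter word xy as a subsequence if and only if v admits xy as a subsequence. -/

import Mathlib

open FreeMonoid

/-- The alphabet `A = {1 < 2 < 3 < ...}` of positive integers. -/
abbrev Alph : Type := ℕ+

/-- The finite alphabet `A_n = {1 < ... < n}`. -/
abbrev AlphN (n : ℕ) : Type := {a : ℕ+ // (a : ℕ) ≤ n}

/-- The defining relations of the hypoplactic monoid. -/
def HypoRel (u v : FreeMonoid Alph) : Prop :=
  (∃ a b c : Alph, a ≤ b ∧ b < c ∧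
      u = of a * of c * of b ∧ v = of c * of a * of b) ∨
  (∃ a b c : Alph, a < b ∧ b ≤ c ∧
      u = of b * of a * of c ∧ v = of b * of c * of a) ∨
  (∃ a b c d : Alph, a ≤ b ∧ b < c ∧ c ≤ d ∧
      u = of c * of a * of d * of b ∧ v = of a * of c * of b * of d) ∨
  (∃ a b c d : Alph, a < b ∧ b ≤ c ∧ c < d ∧
      u = of b * of d * of a * of c ∧ v = of d * of b * of c * of a)

/-- The hypoplactic congruence on `A*`: the congruence generated by `HypoRel`. -/
def hypoCon : Con (FreeMonoid Alph) := conGen HypoRel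

/-- The infinite-rank hypoplactic monoid `hypo`. -/
abbrev Hypo : Type := hypoCon.Quotient

/-- The inclusion of `A_n*` into `A*`. -/
def inclN (n : ℕ) : FreeMonoid (AlphN n) →* FreeMonoid Alph :=
  FreeMonoid.map Subtype.val

/-- The hypoplactic congruence restricted to `A_n*`. -/
def hypoConN (n : ℕ) : Con (FreeMonoid (AlphN n)) :=
  hypoCon.comap (inclN n) (fun x y => map_mul (inclN n) x y)

/-- The rank-`n` hypoplactic monoid `hypo_n`. -/
abbrev HypoN (n : ℕ) : Type := (hypoConN n).Quotient

/-- The letter `1` of `A_2`. -/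
def a1 : AlphN 2 := ⟨1, by norm_num⟩

/-- The letter `2` of `A_2`. -/
def a2 : AlphN 2 := ⟨2, by norm_num⟩

/-- The homomorphism `φ_{ij} : A* → hypo_2`, sending `i ↦ [1]`, `j ↦ [2]`,
`a ↦ [21]` for `i < a < j`, and every other letter to the identity. -/
def phi (i j : Alph) : FreeMonoid Alph →* HypoN 2 :=
  FreeMonoid.lift fun a =>
    if a = i then (hypoConN 2).mk' (of a1)
    else if a = j then (hypoConN 2).mk' (of a2)
    else if i < a ∧ a < j then (hypoConN 2).mk' (of a2 * of a1)
    else 1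

/-- A monoid `M` satisfies the identity `u ≈ v` (over the alphabet of variables `X`)
if every homomorphic evaluation of the two words in `M` gives equal values. -/
def MSatisfies (M : Type*) [Monoid M] {X : Type*} (u v : FreeMonoid X) : Prop :=
  ∀ ψ : FreeMonoid X →* M, ψ u = ψ v

/-- An identity `u ≈ v` is balanced if every variable occurs the same number of
times in `u` as in `v`. -/
def IsBalanced {X : Type*} [DecidableEq X] (u v : FreeMonoid X) : Prop :=
  ∀ x : X, u.toList.count x = v.toList.count x

/-- A map from an ordered alphabet to a monoid that respects the hypoplactic relations. -/
structure IsHypoplactic {α M : Type*} [LinearOrder α] [Monoid M] (g : α → M) : Prop where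
  acb : ∀ {a b c : α}, a ≤ b → b < c → g a * (g c * g b) = g c * (g a * g b)
  bac : ∀ {a b c : α}, a < b → b ≤ c → g b * (g a * g c) = g b * (g c * g a)
  cadb : ∀ {a b c d : α}, a ≤ b → b < c → c ≤ d →
    g c * (g a * (g d * g b)) = g a * (g c * (g b * g d))
  bdac : ∀ {a b c d : α}, a < b → b ≤ c → c < d →
    g b * (g d * (g a * g c)) = g d * (g b * (g c * g a))

/-- The evaluation of a word under a map from letters to a monoid. -/
def evalWord {α M : Type*} [Monoid M] (g : α → M) (s : List α) : M := (s.map g).prod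

section evalWord

variable {α M : Type*} [Monoid M] (g : α → M)

@[simp] theorem evalWord_nil : evalWord g [] = 1 := rfl

@[simp] theorem evalWord_cons (a : α) (s : List α) :
    evalWord g (a :: s) = g a * evalWord g s := by simp [evalWord]

@[simp] theorem evalWord_append (s t : List α) :
    evalWord g (s ++ t) = evalWord g s * evalWord g t := by simp [evalWord]

end evalWord

/-- Two letters `a < c` commute in front of any word that contains a letter `b` with
`a ≤ b < c`, for words `s` of bounded length between the letters and `b`. -/
def CommBefore {α M : Type*} [LinearOrder α] [Monoid M] (g : α → M) (n : ℕ) : Prop :=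
  ∀ (s : List α) (a b c : α), s.length < n → a ≤ b → b < c →
    g a * (g c * (evalWord g s * g b)) = g c * (g a * (evalWord g s * g b))

/-- Two letters `a < c` commute after any word that contains a letter `b` with
`a < b ≤ c`, for words `s` of bounded length between `b` and the letters. -/
def CommAfter {α M : Type*} [LinearOrder α] [Monoid M] (g : α → M) (n : ℕ) : Prop :=
  ∀ (s : List α) (a b c : α), s.length < n → a < b → b ≤ c →
    g b * (evalWord g s * (g a * g c)) = g b * (evalWord g s * (g c * g a))

section Duality

variable {α M : Type*} [Monoid M] {g : α → M}

/-- The map on the dual alphabet to the opposite monoid. -/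
def dualMap (g : α → M) : αᵒᵈ → Mᵐᵒᵖ := fun a => MulOpposite.op (g (OrderDual.ofDual a))

theorem evalWord_dualMap (s : List α) :
    evalWord (dualMap g) (s.map OrderDual.toDual) = MulOpposite.op (evalWord g s.reverse) := by
  induction s with
  | nil => simp
  | cons a s ih => simp [ih, dualMap]

variable [LinearOrder α]

theorem IsHypoplactic.dual (hg : IsHypoplactic g) : IsHypoplactic (dualMap g) where
  acb {a b c} hab hbc := by
    have := hg.bac (a := c.ofDual) (b := b.ofDual) (c := a.ofDual) hbc hab
    simpa [dualMap, ← MulOpposite.op_mul, mul_assoc] using this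
  bac {a b c} hab hbc := by
    have := hg.acb (a := c.ofDual) (b := b.ofDual) (c := a.ofDual) hbc hab
    simpa [dualMap, ← MulOpposite.op_mul, mul_assoc] using this
  cadb {a b c d} hab hbc hcd := by
    have := hg.cadb (a := d.ofDual) (b := c.ofDual) (c := b.ofDual) (d := a.ofDual) hcd hbc hab
    simpa [dualMap, ← MulOpposite.op_mul, mul_assoc] using this
  bdac {a b c d} hab hbc hcd := by
    have := hg.bdac (a := d.ofDual) (b := c.ofDual) (c := b.ofDual) (d := a.ofDual) hcd hbc hab
    simpa [dualMap, ← MulOpposite.op_mul, mul_assoc] using this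

theorem CommBefore.of_dual {n : ℕ} (h : CommBefore (dualMap g) n) : CommAfter g n := by
  intro s a b c hs hab hbc
  have := h (s.reverse.map OrderDual.toDual) (OrderDual.toDual c) (OrderDual.toDual b)
    (OrderDual.toDual a) (by simpa using hs) hbc hab
  rw [evalWord_dualMap] at this
  simpa [dualMap, ← MulOpposite.op_mul, mul_assoc] using this

end Duality

section Commutation

variable {α M : Type*} [LinearOrder α] [Monoid M] {g : α → M} {n : ℕ}

theorem CommBefore.tail (h : CommBefore g n) (s : List α) {a b c : α} (hs : s.length < n)
    (hab : a ≤ b) (hbc : b < c) (t : M) :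
    g a * (g c * (evalWord g s * (g b * t))) = g c * (g a * (evalWord g s * (g b * t))) := by
  simpa [mul_assoc] using congrArg (· * t) (h s a b c hs hab hbc)

theorem CommAfter.tail (h : CommAfter g n) (s : List α) {a b c : α} (hs : s.length < n)
    (hab : a < b) (hbc : b ≤ c) (t : M) :
    g b * (evalWord g s * (g a * (g c * t))) = g b * (evalWord g s * (g c * (g a * t))) := by
  simpa [mul_assoc] using congrArg (· * t) (h s a b c hs hab hbc)

/-- A letter below `b` can be moved through letters above `b` in front of `b`. -/
theorem CommBefore.move_small (h : CommBefore g n) {b e : α} (he : e ≤ b) :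
    ∀ t : List α, t.length ≤ n → (∀ x ∈ t, b < x) →
      g e * (evalWord g t * g b) = evalWord g t * (g e * g b)
  | [], _, _ => by simp
  | x :: t, hn, ht => by
    have hn' : t.length < n := by simpa using hn
    have := h.move_small he t hn'.le fun y hy => ht y (List.mem_cons_of_mem _ hy)
    simp only [evalWord_cons, mul_assoc]
    rw [h t e b x hn' he (ht x List.mem_cons_self), this]

/-- A letter above `b` can be moved through letters below `b` in front of `b`. -/
theorem CommBefore.move_large (h : CommBefore g n) {b e : α} (he : b < e) :
    ∀ t : List α, t.length ≤ n → (∀ x ∈ t, x ≤ b) →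
      g e * (evalWord g t * g b) = evalWord g t * (g e * g b)
  | [], _, _ => by simp
  | x :: t, hn, ht => by
    have hn' : t.length < n := by simpa using hn
    have := h.move_large he t hn'.le fun y hy => ht y (List.mem_cons_of_mem _ hy)
    simp only [evalWord_cons, mul_assoc]
    rw [← h t x b e hn' (ht x List.mem_cons_self) he, this]

/-- A word that has letters both below and above `b` can be rearranged in front of `b` so that
it ends in a letter above `b` followed by a letter below `b`. -/
theorem CommBefore.exists_mixed_end (h : CommBefore g n) {a b c : α} (hab : a ≤ b) (hbc : b < c) :
    ∀ s : List α, s.length ≤ n → (∀ x ∈ s, x < a ∨ c ≤ x) → (∃ x ∈ s, x < a) →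
      (∃ x ∈ s, c ≤ x) → ∃ (r : List α) (d e : α), r.length + 2 = s.length ∧ c ≤ d ∧ e < a ∧
        evalWord g s * g b = evalWord g r * (g d * (g e * g b))
  | [], _, _, hx, _ => by simp at hx
  | x :: s, hn, hs, hx, hy => by
    have hn' : s.length < n := by simpa using hn
    have hs' : ∀ y ∈ s, y < a ∨ c ≤ y := fun y hy => hs y (List.mem_cons_of_mem _ hy)
    by_cases h₁ : ∃ y ∈ s, y < a
    · by_cases h₂ : ∃ y ∈ s, c ≤ y
      · obtain ⟨r, d, e, hr, hd, he, H⟩ := h.exists_mixed_end hab hbc s hn'.le hs' h₁ h₂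
        exact ⟨x :: r, d, e, by simp [← hr], hd, he, by simp [mul_assoc, H]⟩
      · push Not at h₂
        have hcx : c ≤ x := by
          obtain ⟨y, hy, hcy⟩ := hy
          rcases List.mem_cons.1 hy with rfl | hy
          · exact hcy
          · exact absurd hcy (h₂ y hy).not_ge
        have hsmall : ∀ y ∈ s, y < a := fun y hy => (hs' y hy).resolve_right (h₂ y hy).not_ge
        rcases List.eq_nil_or_concat s with rfl | ⟨r, e, rfl⟩
        · simp at h₁
        · have he : e < a := hsmall e (by simp)
          have hm := h.move_large (hbc.trans_le hcx) _ hn'.le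
            fun y hy => (hsmall y hy).le.trans hab
          refine ⟨r, x, e, by simp, hcx, he, ?_⟩
          have h₀ := h [] e b x (by simp at hn'; simp; omega) (he.le.trans hab) (hbc.trans_le hcx)
          simp only [evalWord_nil, one_mul] at h₀
          rw [evalWord_cons, mul_assoc, hm]
          simp [mul_assoc, h₀]
    · push Not at h₁
      have hlarge : ∀ y ∈ s, c ≤ y := fun y hy => (hs' y hy).resolve_left (h₁ y hy).not_gt
      have hxa : x < a := by
        obtain ⟨y, hy, hya⟩ := hx
        rcases List.mem_cons.1 hy with rfl | hy
        · exact hya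
        · exact absurd hya (h₁ y hy).not_gt
      rcases List.eq_nil_or_concat s with rfl | ⟨r, d, rfl⟩
      · obtain ⟨y, hy, hcy⟩ := hy
        obtain rfl : y = x := by simpa using hy
        exact absurd (hxa.trans_le hab) (hbc.trans_le hcy).not_gt
      · have hd : c ≤ d := hlarge d (by simp)
        have hm := h.move_small (hxa.le.trans hab) _ hn'.le
          fun y hy => hbc.trans_le (hlarge y hy)
        refine ⟨r, d, x, by simp, hd, hxa, ?_⟩
        rw [evalWord_cons, mul_assoc, hm]
        simp [mul_assoc]

/-- The commutation step for a word with a letter above `b` and a letter below `b` at its end. -/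
theorem CommBefore.swap_mixed (hA : CommBefore g n) (hB : CommAfter g n) {a b c d e : α}
    (hab : a ≤ b) (hbc : b < c) (hd : c ≤ d) (he : e < a) {r : List α} (hr : r.length + 2 = n) :
    g a * (g c * (evalWord g r * (g d * (g e * g b)))) =
      g c * (g a * (evalWord g r * (g d * (g e * g b)))) := by
  have hde := hA [] e b d (by simp; omega) (he.le.trans hab) (hbc.trans_le hd)
  have hcdb := hB (r ++ [e]) b c d (by simp; omega) hbc hd
  have hace := hA.tail (r ++ [e]) (by simp; omega) hab hbc (g d)
  have haeb := hB.tail r (by omega) he hab (g d)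
  have hbed := hB [] e b d (by simp; omega) (he.trans_le hab) (hbc.le.trans hd)
  have hacb := hA.tail r (by omega) hab hbc (g d * g e)
  have hcbd := hB.tail r (by omega) hbc hd (g e)
  have hacd := hA.tail (r ++ [d]) (by simp; omega) hab hbc (g e)
  have haeb' := hB (r ++ [d]) e a b (by simp; omega) he hab
  simp only [evalWord_nil, one_mul, evalWord_append, evalWord_cons, mul_one, mul_assoc] at *
  calc
    _ = g a * (g c * (evalWord g r * (g e * (g d * g b)))) := by rw [hde]
    _ = g a * (g c * (evalWord g r * (g e * (g b * g d)))) := by rw [hcdb]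
    _ = g c * (g a * (evalWord g r * (g e * (g b * g d)))) := hace
    _ = g c * (g a * (evalWord g r * (g b * (g d * g e)))) := by rw [haeb, hbed]
    _ = g a * (g c * (evalWord g r * (g d * (g b * g e)))) := by rw [← hacb, hcbd]
    _ = _ := by rw [hacd, haeb']

/-- The commutation step for a word whose letters lie outside the interval `[a, c)` and whose
first and last letters lie on the same side of it. -/
theorem CommBefore.swap_ends (hA : CommBefore g n) (hB : CommAfter g n) {a b c d e : α}
    (hab : a ≤ b) (hbc : b < c) (hed : (e < a ∧ d < a) ∨ (c ≤ e ∧ c ≤ d)) {m : List α}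
    (hm : m.length + 2 = n) :
    g a * (g c * (g e * (evalWord g m * (g d * g b)))) =
      g c * (g a * (g e * (evalWord g m * (g d * g b)))) := by
  have hac := hA.tail (e :: m) (by simp; omega) hab hbc (g d)
  have hacd := hA (m ++ [d]) a b c (by simp; omega) hab hbc
  simp only [evalWord_append, evalWord_cons, evalWord_nil, mul_one, mul_assoc] at hac hacd
  rcases hed with ⟨he, hd⟩ | ⟨he, hd⟩
  · rcases le_or_gt e d with h | h
    · have hec := hA.tail m (by omega) h (hd.trans_le (hab.trans hbc.le)) (g b)
      have hea := hA.tail m (by omega) h hd (g b)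
      have hea' := congrArg (g e * ·) hacd
      have hec' := hA.tail (a :: m) (by simp; omega) h (hd.trans_le (hab.trans hbc.le)) (g b)
      have hea'' := hA.tail (c :: m) (by simp; omega) h hd (g b)
      simp only [evalWord_cons, mul_assoc] at hec' hea''
      rw [← hec, ← hea, ← hea'', ← hec']
      exact hea'
    · have hdb := hB m d e b (by omega) h (he.le.trans hab)
      rw [hdb, hac]
  · rcases le_or_gt e d with h | h
    · have hdb := hB m b e d (by omega) (hbc.trans_le he) h
      rw [← hdb, hac]
    · have hce := hA.tail m (by omega) hd h (g b)
      have hae := hA (m ++ [d]) a b e (by simp; omega) hab (hbc.trans_le he)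
      have hcd := hB m b c d (by omega) hbc hd
      have hae' := hA.tail (c :: m) (by simp; omega) hab (hbc.trans_le he) (g d)
      have hce' := hA.tail (a :: m) (by simp; omega) hd h (g b)
      simp only [evalWord_append, evalWord_cons, evalWord_nil, mul_one, mul_assoc]
        at hae hae' hce'
      rw [hae, hce', hce, ← hcd, hae', hcd, hacd]

theorem CommBefore.succ (hg : IsHypoplactic g) (hA : CommBefore g n) (hB : CommAfter g n) :
    CommBefore g (n + 1) := by
  intro s a b c hs hab hbc
  rcases (Nat.lt_succ_iff.1 hs).lt_or_eq with hs | hs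
  · exact hA s a b c hs hab hbc
  by_cases hmid : ∃ x ∈ s, a ≤ x ∧ x < c
  · obtain ⟨x, hx, hax, hxc⟩ := hmid
    obtain ⟨s₁, s₂, rfl⟩ := List.append_of_mem hx
    have := hA.tail s₁ (by simp at hs; omega) hax hxc (evalWord g s₂ * g b)
    simpa [mul_assoc] using this
  have hout : ∀ x ∈ s, x < a ∨ c ≤ x := by
    intro x hx
    by_contra! h
    exact hmid ⟨x, hx, h⟩
  by_cases hmixed : (∃ x ∈ s, x < a) ∧ ∃ x ∈ s, c ≤ x
  · obtain ⟨r, d, e, hr, hd, he, H⟩ :=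
      hA.exists_mixed_end hab hbc s hs.le hout hmixed.1 hmixed.2
    rw [H]
    exact hA.swap_mixed hB hab hbc hd he (hr.trans hs)
  have hsame : (∀ x ∈ s, x < a) ∨ ∀ x ∈ s, c ≤ x := by
    by_contra! h
    obtain ⟨⟨x, hx, hxa⟩, y, hy, hyc⟩ := h
    exact hmixed ⟨⟨y, hy, (hout y hy).resolve_right hyc.not_ge⟩,
      ⟨x, hx, (hout x hx).resolve_left hxa.not_gt⟩⟩
  rcases s with _ | ⟨e, s⟩
  · simpa using hg.acb hab hbc
  rcases List.eq_nil_or_concat s with rfl | ⟨m, d, rfl⟩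
  · simp only [evalWord_cons, evalWord_nil, mul_one]
    rcases hsame with h | h
    · have he : e < a := h e (by simp)
      rw [hg.bdac he hab hbc, hg.bac he hab]
    · have he : c ≤ e := h e (by simp)
      rw [hg.cadb hab hbc he, hg.bac hbc he]
  · have := hA.swap_ends hB (d := d) (e := e) (m := m) hab hbc
      (hsame.imp (fun h => ⟨h e (by simp), h d (by simp)⟩)
        fun h => ⟨h e (by simp), h d (by simp)⟩) (by simpa using hs)
    simpa [mul_assoc] using this

end Commutation

theorem IsHypoplactic.commBefore (n : ℕ) : ∀ {α M : Type} [LinearOrder α] [Monoid M] {g : α → M},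
    IsHypoplactic g → CommBefore g n := by
  induction n with
  | zero => intro α M _ _ g _ s a b c hs; simp at hs
  | succ n ih => intro α M _ _ g hg; exact (ih hg).succ hg (ih hg.dual).of_dual

theorem IsHypoplactic.commAfter {α M : Type} [LinearOrder α] [Monoid M] {g : α → M}
    (hg : IsHypoplactic g) (n : ℕ) : CommAfter g n :=
  (hg.dual.commBefore n).of_dual

/-- Adjacent letters `a < c` commute in a word that has a suitable letter `b` elsewhere. -/
theorem IsHypoplactic.swap {α M : Type} [LinearOrder α] [Monoid M] {g : α → M}
    (hg : IsHypoplactic g) {p q : List α} {a c : α}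
    (h : (∃ b ∈ p, a < b ∧ b ≤ c) ∨ ∃ b ∈ q, a ≤ b ∧ b < c) :
    evalWord g (p ++ a :: c :: q) = evalWord g (p ++ c :: a :: q) := by
  rcases h with ⟨b, hb, hab, hbc⟩ | ⟨b, hb, hab, hbc⟩
  · obtain ⟨p₁, p₂, rfl⟩ := List.append_of_mem hb
    have := (hg.commAfter _).tail p₂ (Nat.lt_succ_self _) hab hbc (evalWord g q)
    simp [this]
  · obtain ⟨q₁, q₂, rfl⟩ := List.append_of_mem hb
    have := (hg.commBefore _).tail q₁ (Nat.lt_succ_self _) hab hbc (evalWord g q₂)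
    simp [this]

section PairSublist

variable {α β : Type*}

theorem pair_sublist_cons {a b x : α} {l : List α} :
    [b, a].Sublist (x :: l) ↔ (b = x ∧ a ∈ l) ∨ [b, a].Sublist l := by
  rw [List.sublist_cons_iff]
  simp [or_comm, eq_comm]

theorem pair_sublist_append {a b : α} {l m : List α} :
    [b, a].Sublist (l ++ m) ↔ [b, a].Sublist l ∨ (b ∈ l ∧ a ∈ m) ∨ [b, a].Sublist m := by
  induction l with
  | nil => simp
  | cons x l ih =>
    simp only [List.cons_append, pair_sublist_cons, ih, List.mem_append, List.mem_cons]
    tauto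

theorem pair_sublist_flatMap {f : α → List β} {a b : β} {l : List α} :
    [b, a].Sublist (l.flatMap f) ↔ (∃ x ∈ l, [b, a].Sublist (f x)) ∨
      ∃ x y, [x, y].Sublist l ∧ b ∈ f x ∧ a ∈ f y := by
  induction l with
  | nil => simp
  | cons z l ih =>
    simp only [List.flatMap_cons, pair_sublist_append, ih, pair_sublist_cons, List.mem_flatMap,
      List.mem_cons]
    constructor
    · rintro (h | ⟨hb, y, hy, ha⟩ | ⟨x, hx, h⟩ | ⟨x, y, hxy, h⟩)
      · exact .inl ⟨z, .inl rfl, h⟩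
      · exact .inr ⟨z, y, .inl ⟨rfl, hy⟩, hb, ha⟩
      · exact .inl ⟨x, .inr hx, h⟩
      · exact .inr ⟨x, y, .inr hxy, h⟩
    · rintro (⟨x, rfl | hx, h⟩ | ⟨x, y, ⟨rfl, hy⟩ | hxy, hb, ha⟩)
      · exact .inl h
      · exact .inr (.inr (.inl ⟨x, hx, h⟩))
      · exact .inr (.inl ⟨hb, y, hy, ha⟩)
      · exact .inr (.inr (.inr ⟨x, y, hxy, hb, ha⟩))

theorem mem_of_pair_sublist {a b : α} {l : List α} (h : [b, a].Sublist l) : b ∈ l ∧ a ∈ l :=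
  ⟨h.subset (by simp), h.subset (by simp)⟩

theorem pair_self_sublist_iff [DecidableEq α] {a : α} {l : List α} :
    [a, a].Sublist l ↔ 2 ≤ l.count a :=
  (List.replicate_sublist_iff (n := 2))

end PairSublist

/-- Two words have the same content and the same inversions between letters that are
consecutive in the support. -/
def SameInversions {α : Type*} [LinearOrder α] (w w' : List α) : Prop :=
  w.Perm w' ∧ ∀ a b, a < b → (∀ c ∈ w, a < c → b ≤ c) →
    ([b, a].Sublist w ↔ [b, a].Sublist w')

section SameInversions

variable {α : Type*} [LinearOrder α] {w w' z z' : List α}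

theorem SameInversions.symm (h : SameInversions w w') : SameInversions w' w :=
  ⟨h.1.symm, fun a b hab hc => (h.2 a b hab fun c hcw => hc c (h.1.mem_iff.1 hcw)).symm⟩

theorem SameInversions.trans (h : SameInversions w w') (h' : SameInversions w' z) :
    SameInversions w z :=
  ⟨h.1.trans h'.1, fun a b hab hc => (h.2 a b hab hc).trans
    (h'.2 a b hab fun c hcw => hc c (h.1.mem_iff.2 hcw))⟩

theorem SameInversions.append (h : SameInversions w w') (h' : SameInversions z z') :
    SameInversions (w ++ z) (w' ++ z') := by
  refine ⟨h.1.append h'.1, fun a b hab hc => ?_⟩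
  rw [pair_sublist_append, pair_sublist_append,
    h.2 a b hab fun c hcw => hc c (by simp [hcw]),
    h'.2 a b hab fun c hcw => hc c (by simp [hcw]), h.1.mem_iff, h'.1.mem_iff]

end SameInversions

/-- The congruence of having the same content and the same consecutive inversions. -/
def inversionCon : Con (FreeMonoid Alph) where
  r u v := SameInversions u.toList v.toList
  iseqv := ⟨fun _ => ⟨.refl _, fun _ _ _ _ => Iff.rfl⟩, .symm, .trans⟩
  mul' := fun h h' => by simpa using h.append h'

theorem HypoRel.sameInversions {u v : FreeMonoid Alph} (h : HypoRel u v) :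
    SameInversions u.toList v.toList := by
  rcases h with ⟨a, b, c, h₁, h₂, rfl, rfl⟩ | ⟨a, b, c, h₁, h₂, rfl, rfl⟩ |
    ⟨a, b, c, d, h₁, h₂, h₃, rfl, rfl⟩ | ⟨a, b, c, d, h₁, h₂, h₃, rfl, rfl⟩
  all_goals
    refine ⟨?_, fun x y hxy hc => ?_⟩
    · rw [List.perm_iff_count]
      intro x
      simp [List.count_cons]
      try omega
    · simp [pair_sublist_cons] at hc ⊢
      grind

theorem hypoCon_le_inversionCon : hypoCon ≤ inversionCon :=
  Con.conGen_le.2 fun _ _ h => h.sameInversions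

/-- The class of a letter in the hypoplactic monoid. -/
def hypoLetter (a : Alph) : Hypo := hypoCon.mk' (of a)

theorem evalWord_hypoLetter (s : List Alph) :
    evalWord hypoLetter s = hypoCon.mk' (ofList s) := by
  induction s with
  | nil => rfl
  | cons a s ih => rw [evalWord_cons, ih, ofList_cons, map_mul]; rfl

theorem sameInversions_of_evalWord_eq {s t : List Alph}
    (h : evalWord hypoLetter s = evalWord hypoLetter t) : SameInversions s t := by
  rw [evalWord_hypoLetter, evalWord_hypoLetter] at h
  exact hypoCon_le_inversionCon (hypoCon.eq.1 h)

theorem isHypoplactic_hypoLetter : IsHypoplactic hypoLetter where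
  acb {a b c} h₁ h₂ := by
    have := hypoCon.eq.2 (ConGen.Rel.of _ _ (.inl ⟨a, b, c, h₁, h₂, rfl, rfl⟩))
    simpa [hypoLetter, mul_assoc] using this
  bac {a b c} h₁ h₂ := by
    have := hypoCon.eq.2 (ConGen.Rel.of _ _ (.inr (.inl ⟨a, b, c, h₁, h₂, rfl, rfl⟩)))
    simpa [hypoLetter, mul_assoc] using this
  cadb {a b c d} h₁ h₂ h₃ := by
    have := hypoCon.eq.2
      (ConGen.Rel.of _ _ (.inr (.inr (.inl ⟨a, b, c, d, h₁, h₂, h₃, rfl, rfl⟩))))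
    simpa [hypoLetter, mul_assoc] using this
  bdac {a b c d} h₁ h₂ h₃ := by
    have := hypoCon.eq.2
      (ConGen.Rel.of _ _ (.inr (.inr (.inr ⟨a, b, c, d, h₁, h₂, h₃, rfl, rfl⟩))))
    simpa [hypoLetter, mul_assoc] using this

/-- A letter can be moved to the front of a word when every letter it has to pass either
has a witness for the exchange outside the word or a letter strictly between the two. -/
theorem evalWord_move_front {p q : List Alph} {x : Alph} :
    ∀ r : List Alph,
      (∀ y ∈ r, (∃ z ∈ p ++ r ++ q, min x y < z ∧ z < max x y) ∨
        (min x y < max x y ∧ (max x y ∈ p ∨ min x y ∈ q))) →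
      evalWord hypoLetter (p ++ (r ++ x :: q)) = evalWord hypoLetter (p ++ x :: (r ++ q)) := by
  intro r
  induction r generalizing p with
  | nil => simp
  | cons y r ih =>
    intro h
    have hr := ih (p := p ++ [y]) fun z hz => by
      rcases h z (by simp [hz]) with ⟨b, hb, H⟩ | ⟨hlt, H | H⟩
      · exact .inl ⟨b, by simpa using hb, H⟩
      · exact .inr ⟨hlt, .inl (by simp [H])⟩
      · exact .inr ⟨hlt, .inr H⟩
    have hy : (∃ b ∈ p, min x y < b ∧ b ≤ max x y) ∨
        ∃ b ∈ r ++ q, min x y ≤ b ∧ b < max x y := by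
      rcases h y (by simp) with ⟨b, hb, H⟩ | ⟨hlt, H | H⟩
      · have hby : b ≠ y := by
          rintro rfl
          rcases le_total x b with h | h <;> simp [h] at H
        simp only [List.mem_append, List.mem_cons, hby, false_or] at hb
        rcases hb with (hb | hb) | hb
        · exact .inl ⟨b, hb, H.1, H.2.le⟩
        · exact .inr ⟨b, by simp [hb], H.1.le, H.2⟩
        · exact .inr ⟨b, by simp [hb], H.1.le, H.2⟩
      · exact .inl ⟨_, H, hlt, le_rfl⟩
      · exact .inr ⟨_, by simp [H], le_rfl, hlt⟩
    have hs := isHypoplactic_hypoLetter.swap hy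
    calc
      _ = evalWord hypoLetter (p ++ y :: x :: (r ++ q)) := by simpa using hr
      _ = _ := by
        rcases le_total x y with h | h
        · simpa [h] using hs.symm
        · simpa [h] using hs

/-- Words with the same content and the same consecutive inversions are hypoplactically
congruent. -/
theorem evalWord_eq_of_sameInversions (w' : List Alph) : ∀ p w : List Alph,
    SameInversions (p ++ w) (p ++ w') →
      evalWord hypoLetter (p ++ w) = evalWord hypoLetter (p ++ w') := by
  induction w' with
  | nil =>
    intro p w h
    have : w.Perm [] := (List.perm_append_left_iff p).1 h.1
    rw [this.eq_nil]
  | cons x w' ih =>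
    intro p w h
    have hperm : w.Perm (x :: w') := (List.perm_append_left_iff p).1 h.1
    obtain ⟨r, q, rfl, hxr⟩ := List.eq_append_cons_of_mem (hperm.mem_iff.2 List.mem_cons_self)
    have hperm' : (r ++ q).Perm w' := (List.perm_middle.symm.trans hperm).cons_inv
    have hmove := evalWord_move_front (p := p) (q := q) (x := x) r fun y hy => by
      by_cases hbetween : ∃ z ∈ p ++ r ++ q, min x y < z ∧ z < max x y
      · exact .inl hbetween
      push Not at hbetween
      have hne : y ≠ x := fun h => hxr (h ▸ hy)
      have hlt : min x y < max x y := min_lt_max.2 hne.symm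
      refine .inr ⟨hlt, ?_⟩
      have hinv := h.2 _ _ hlt fun c hc hcx => by
        by_cases hcx' : c = x
        · subst hcx'
          rcases le_total c y with h | h <;> simp_all
        · exact hbetween c (by simp_all) hcx
      by_contra! hcon
      have hyw : y ∈ w' := hperm'.mem_iff.1 (by simp [hy])
      rcases lt_or_gt_of_ne hne with hyx | hxy
      · simp only [min_eq_right hyx.le, max_eq_left hyx.le] at hinv hcon
        have h₁ := hinv.2 (by simp [hyw])
        simp only [pair_sublist_append, pair_sublist_cons, List.mem_cons] at h₁
        have := @mem_of_pair_sublist _ y x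
        grind
      · simp only [min_eq_left hxy.le, max_eq_right hxy.le] at hinv hcon
        have h₁ := hinv.1 (by simp [pair_sublist_append, pair_sublist_cons, hy])
        have hxw : x ∉ w' := fun hx => by
          have := hperm'.mem_iff.2 hx
          simp_all
        simp only [pair_sublist_append, pair_sublist_cons, List.mem_cons] at h₁
        have := @mem_of_pair_sublist _ x y
        grind
    rw [hmove]
    have := ih (p ++ [x]) (r ++ q)
      (by simpa using (sameInversions_of_evalWord_eq hmove).symm.trans h)
    simpa using this

theorem hom_eq_evalWord_flatMap {X : Type*} (ψ : FreeMonoid X →* Hypo) (f : X → List Alph)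
    (hf : ∀ x, ψ (of x) = evalWord hypoLetter (f x)) (l : List X) :
    ψ (ofList l) = evalWord hypoLetter (l.flatMap f) := by
  induction l with
  | nil => simp
  | cons x l ih => rw [ofList_cons, map_mul, ih, hf, List.flatMap_cons, evalWord_append]

theorem exists_evalWord_eq (m : Hypo) : ∃ s, evalWord hypoLetter s = m := by
  obtain ⟨w, rfl⟩ := Con.mk'_surjective m
  exact ⟨w.toList, evalWord_hypoLetter _⟩

/-- A satisfied identity gives words with the same inversions under every substitution. -/
theorem MSatisfies.sameInversions {X : Type*} {u v : FreeMonoid X} (h : MSatisfies Hypo u v)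
    (f : X → List Alph) : SameInversions (u.toList.flatMap f) (v.toList.flatMap f) := by
  apply sameInversions_of_evalWord_eq
  have hf := hom_eq_evalWord_flatMap (FreeMonoid.lift fun x => evalWord hypoLetter (f x)) f
    (fun x => by simp)
  rw [← hf, ← hf]
  simpa using h _

theorem MSatisfies.isBalanced {X : Type*} [DecidableEq X] {u v : FreeMonoid X}
    (h : MSatisfies Hypo u v) : IsBalanced u v := by
  intro x
  have key : ∀ l : List X,
      (l.flatMap fun y => if y = x then [(1 : Alph)] else []).length = l.count x := by
    intro l
    induction l with
    | nil => rfl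
    | cons y l ih => by_cases hy : y = x <;> simp_all
  rw [← key, ← key]
  exact (h.sameInversions _).1.length_eq

theorem MSatisfies.pair_sublist_iff {X : Type*} [DecidableEq X] {u v : FreeMonoid X}
    (h : MSatisfies Hypo u v) {x y : X} (hxy : x ≠ y) :
    [x, y].Sublist u.toList ↔ [x, y].Sublist v.toList := by
  let f : X → List Alph := fun z => if z = x then [2] else if z = y then [1] else []
  have key : ∀ l : List X, [(2 : Alph), 1].Sublist (l.flatMap f) ↔ [x, y].Sublist l := by
    intro l
    have hx : ∀ z, (2 : Alph) ∈ f z ↔ z = x := fun z => by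
      by_cases hzx : z = x
      · simp [f, hzx]
      · by_cases hzy : z = y <;> simp [f, hzy, hxy.symm]
    have hy : ∀ z, (1 : Alph) ∈ f z ↔ z = y := fun z => by
      by_cases hzx : z = x
      · subst hzx; simp [f, hxy]
      · by_cases hzy : z = y <;> simp [f, hzx, hzy, hxy.symm]
    have hf : ∀ z, ¬ [(2 : Alph), 1].Sublist (f z) := fun z hz => by
      have := mem_of_pair_sublist hz
      rw [hx, hy] at this
      exact hxy (this.1.symm.trans this.2)
    rw [pair_sublist_flatMap]
    simp [hx, hy, hf]
  rw [← key, ← key]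
  refine (h.sameInversions f).2 1 2 (by decide) fun c _ hc => ?_
  exact PNat.add_one_le_iff.2 hc

/-- An identity `u ≈ v` is satisfied by `hypo` if and only if it is balanced and,
for all variables `x, y` occurring in `u` or `v`, the word `u` admits `xy` as a
subsequence if and only if `v` does too. -/
theorem hypo_identities_characterization {X : Type*} [DecidableEq X]
    (u v : FreeMonoid X) :
    MSatisfies Hypo u v ↔
      (IsBalanced u v ∧
        ∀ x y : X, (x ∈ u.toList ∨ x ∈ v.toList) → (y ∈ u.toList ∨ y ∈ v.toList) →
          (List.Sublist [x, y] u.toList ↔ List.Sublist [x, y] v.toList)) := by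
  constructor
  · intro h
    refine ⟨h.isBalanced, fun x y _ _ => ?_⟩
    rcases eq_or_ne x y with rfl | hxy
    · rw [pair_self_sublist_iff, pair_self_sublist_iff, h.isBalanced x]
    · exact h.pair_sublist_iff hxy
  · rintro ⟨hbal, hsub⟩ ψ
    have hperm : u.toList.Perm v.toList := List.perm_iff_count.2 hbal
    choose f hf using fun x => exists_evalWord_eq (ψ (of x))
    have hψ := hom_eq_evalWord_flatMap ψ f fun x => (hf x).symm
    have hu := hψ u.toList
    have hv := hψ v.toList
    rw [ofList_toList] at hu hv
    rw [hu, hv]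
    suffices h : SameInversions (u.toList.flatMap f) (v.toList.flatMap f) from
      evalWord_eq_of_sameInversions _ [] _ h
    refine ⟨hperm.flatMap_right f, fun a b _ _ => ?_⟩
    have hsub' : ∀ x y, [x, y].Sublist u.toList ↔ [x, y].Sublist v.toList := fun x y =>
      ⟨fun h => (hsub x y (.inl (mem_of_pair_sublist h).1) (.inl (mem_of_pair_sublist h).2)).1 h,
        fun h => (hsub x y (.inr (mem_of_pair_sublist h).1) (.inr (mem_of_pair_sublist h).2)).2 h⟩
    rw [pair_sublist_flatMap, pair_sublist_flatMap]
    simp only [hsub', hperm.mem_iff]
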